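/- Let D = ker α∧β be an Engel structure with a choice of Engel defining forms, let R = ⟨T, R⟩ be the associated Reeb distribution, and set c_TR := dβ(R,T). Then R = ker(dβ + c_TR β∧α), and R is integrable if and only if d(c_TR α) ∧ β = 0. -/

import Mathlib

noncomputable section

open Manifold Module Function Set

variable {E : Type*} [NormedAddCommGroup E] [NormedSpace ℝ E]
  {H : Type*} [TopologicalSpace H]

/-- The type of (not necessarily smooth) vector fields on a manifold. -/
abbrev VF (I : ModelWithCorners ℝ E H) (M : Type*) [TopologicalSpace M] [ChartedSpace H M] :=
  ∀ x : M, TangentSpace I x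

/-- A vector field is smooth if the corresponding section of the tangent bundle is smooth. -/
def SmoothVF (I : ModelWithCorners ℝ E H) {M : Type*} [TopologicalSpace M] [ChartedSpace H M]
    [IsManifold I (⊤ : ℕ∞) M] (V : VF I M) : Prop :=
  ContMDiff I I.tangent (⊤ : ℕ∞) (fun x => (⟨x, V x⟩ : TangentBundle I M))

/-- A smooth real valued function on a manifold. -/
def SmoothFn (I : ModelWithCorners ℝ E H) {M : Type*} [TopologicalSpace M] [ChartedSpace H M]
    [IsManifold I (⊤ : ℕ∞) M] (f : M → ℝ) : Prop :=
  ContMDiff I 𝓘(ℝ) (⊤ : ℕ∞) f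

/-- Derivative of a real valued function along a vector field. -/
def vderiv (I : ModelWithCorners ℝ E H) {M : Type*} [TopologicalSpace M] [ChartedSpace H M]
    [IsManifold I (⊤ : ℕ∞) M] (V : VF I M) (f : M → ℝ) : M → ℝ :=
  fun x => mfderiv I 𝓘(ℝ) f x (V x)

/-- The Lie bracket of two vector fields on a manifold, defined by transporting the two
vector fields to the model space via the preferred chart at the given point, taking the
Lie bracket of vector fields there, and transporting the result back.  For smooth vector
fields this is the usual Lie bracket `[V, W]`. -/
def vfLie (I : ModelWithCorners ℝ E H) {M : Type*} [TopologicalSpace M] [ChartedSpace H M]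
    [IsManifold I (⊤ : ℕ∞) M] (V W : VF I M) : VF I M := fun x₀ =>
  mfderiv 𝓘(ℝ, E) I (extChartAt I x₀).symm (extChartAt I x₀ x₀)
    ((VectorField.lieBracket ℝ
      (fun e => (mfderiv I 𝓘(ℝ, E) (extChartAt I x₀) ((extChartAt I x₀).symm e)
        (V ((extChartAt I x₀).symm e)) : E))
      (fun e => (mfderiv I 𝓘(ℝ, E) (extChartAt I x₀) ((extChartAt I x₀).symm e)
        (W ((extChartAt I x₀).symm e)) : E))
      (extChartAt I x₀ x₀) : E))

/-- A smooth differential `1`-form on a manifold, given by its pointwise values. -/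
structure OneForm (I : ModelWithCorners ℝ E H) (M : Type*) [TopologicalSpace M]
    [ChartedSpace H M] [IsManifold I (⊤ : ℕ∞) M] where
  val : ∀ x : M, TangentSpace I x →ₗ[ℝ] ℝ
  smooth' : ∀ V : VF I M, SmoothVF I V → SmoothFn I (fun x => val x (V x))

/-- A smooth differential `k`-form on a manifold, given by its pointwise values. -/
structure FormPt (I : ModelWithCorners ℝ E H) (M : Type*) [TopologicalSpace M]
    [ChartedSpace H M] [IsManifold I (⊤ : ℕ∞) M] (k : ℕ) where
  val : ∀ x : M, (TangentSpace I x) [⋀^Fin k]→ₗ[ℝ] ℝ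
  smooth' : ∀ V : Fin k → VF I M, (∀ i, SmoothVF I (V i)) →
    SmoothFn I (fun x => val x (fun i => V i x))

variable {I : ModelWithCorners ℝ E H} {M : Type*} [TopologicalSpace M] [ChartedSpace H M]
  [IsManifold I (⊤ : ℕ∞) M]

/-- The exterior derivative of a (pointwise defined) `1`-form, evaluated on two vector
fields, via the Cartan formula `dω(V,W) = V (ω W) - W (ω V) - ω [V,W]`.  Here the `1`-form
is given as a function on vector fields. -/
def dOfFun (I : ModelWithCorners ℝ E H) {M : Type*} [TopologicalSpace M] [ChartedSpace H M]
    [IsManifold I (⊤ : ℕ∞) M] (lam : VF I M → M → ℝ) (V W : VF I M) : M → ℝ :=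
  fun x => vderiv I V (lam W) x - vderiv I W (lam V) x - lam (vfLie I V W) x

/-- The exterior derivative of a `1`-form, as a function of two vector fields. -/
def OneForm.d (ω : OneForm I M) (V W : VF I M) : M → ℝ :=
  dOfFun I (fun U x => ω.val x (U x)) V W

/-- A distribution (field of tangent subspaces) on a manifold. -/
abbrev TangentDist (I : ModelWithCorners ℝ E H) (M : Type*) [TopologicalSpace M] [ChartedSpace H M] :=
  ∀ x : M, Submodule ℝ (TangentSpace I x)

/-- A (smooth) section of a distribution. -/
def IsSection (I : ModelWithCorners ℝ E H) {M : Type*} [TopologicalSpace M] [ChartedSpace H M]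
    [IsManifold I (⊤ : ℕ∞) M] (D : TangentDist I M) (V : VF I M) : Prop :=
  SmoothVF I V ∧ ∀ x, V x ∈ D x

/-- The distribution `[D, D]` generated by a distribution `D` together with all Lie brackets
of its sections. -/
def derivedDist (I : ModelWithCorners ℝ E H) {M : Type*} [TopologicalSpace M] [ChartedSpace H M]
    [IsManifold I (⊤ : ℕ∞) M] (D : TangentDist I M) : TangentDist I M := fun x =>
  Submodule.span ℝ
    ({v | ∃ V, IsSection I D V ∧ V x = v} ∪
     {v | ∃ V W, IsSection I D V ∧ IsSection I D W ∧ vfLie I V W x = v})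

/-- A distribution is integrable (in the sense of Frobenius: involutive) if Lie brackets of
its sections are again tangent to it. -/
def IsIntegrableDist (I : ModelWithCorners ℝ E H) {M : Type*} [TopologicalSpace M]
    [ChartedSpace H M] [IsManifold I (⊤ : ℕ∞) M] (D : TangentDist I M) : Prop :=
  ∀ V W, IsSection I D V → IsSection I D W → ∀ x, vfLie I V W x ∈ D x

/-- `(ω ∧ θ)(U,V,W)` for a `1`-form `ω` and a `2`-form `θ` given as a function of two
vector fields. -/
def wedge1_2 (I : ModelWithCorners ℝ E H) {M : Type*} [TopologicalSpace M] [ChartedSpace H M]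
    [IsManifold I (⊤ : ℕ∞) M] (ω : OneForm I M) (θ : VF I M → VF I M → M → ℝ)
    (U V W : VF I M) : M → ℝ := fun x =>
  ω.val x (U x) * θ V W x - ω.val x (V x) * θ U W x + ω.val x (W x) * θ U V x

/-- The square `θ ∧ θ` of a `2`-form `θ` (given as a function of two vector fields) vanishes
identically. -/
def FormSqZero (I : ModelWithCorners ℝ E H) {M : Type*} [TopologicalSpace M] [ChartedSpace H M]
    [IsManifold I (⊤ : ℕ∞) M] (θ : VF I M → VF I M → M → ℝ) : Prop :=
  ∀ V₀ V₁ V₂ V₃ : VF I M, SmoothVF I V₀ → SmoothVF I V₁ → SmoothVF I V₂ → SmoothVF I V₃ →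
    ∀ x, θ V₀ V₁ x * θ V₂ V₃ x - θ V₀ V₂ x * θ V₁ V₃ x + θ V₀ V₃ x * θ V₁ V₂ x = 0

/-- An Engel structure: a rank 2 distribution `D` such that `E := [D,D]` has rank 3 and
`[E,E] = TM`. -/
def IsEngel (I : ModelWithCorners ℝ E H) {M : Type*} [TopologicalSpace M] [ChartedSpace H M]
    [IsManifold I (⊤ : ℕ∞) M] (D : TangentDist I M) : Prop :=
  (∀ x, Module.finrank ℝ (D x) = 2) ∧ (∀ x, Module.finrank ℝ (derivedDist I D x) = 3) ∧
  (∀ x, derivedDist I (derivedDist I D) x = ⊤)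

/-- Engel defining forms: `D = ker α ∩ ker β` and `E = [D,D] = ker α`. -/
def EngelDefiningForms (I : ModelWithCorners ℝ E H) {M : Type*} [TopologicalSpace M]
    [ChartedSpace H M] [IsManifold I (⊤ : ℕ∞) M] (D : TangentDist I M)
    (α β : OneForm I M) : Prop :=
  (∀ x, D x = LinearMap.ker (α.val x) ⊓ LinearMap.ker (β.val x)) ∧
  (∀ x, derivedDist I D x = LinearMap.ker (α.val x))

/-- The pair of Reeb vector fields `T`, `R` associated with Engel defining forms `α`, `β`:
`i_T(α ∧ dβ) = 0`, `β(T) = 1`, `α(T) = 0`, `i_R(β ∧ dβ) = 0`, `β(R) = 0`, `α(R) = 1`. -/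
structure IsReebPair (I : ModelWithCorners ℝ E H) {M : Type*} [TopologicalSpace M]
    [ChartedSpace H M] [IsManifold I (⊤ : ℕ∞) M] (α β : OneForm I M)
    (T R : VF I M) : Prop where
  smoothT : SmoothVF I T
  smoothR : SmoothVF I R
  alphaT : ∀ x, α.val x (T x) = 0
  betaT : ∀ x, β.val x (T x) = 1
  alphaR : ∀ x, α.val x (R x) = 1
  betaR : ∀ x, β.val x (R x) = 0
  insT : ∀ V W, SmoothVF I V → SmoothVF I W → ∀ x, wedge1_2 I α β.d T V W x = 0
  insR : ∀ V W, SmoothVF I V → SmoothVF I W → ∀ x, wedge1_2 I β β.d R V W x = 0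

/-- The Reeb distribution spanned by the two Reeb vector fields. -/
def reebDist (I : ModelWithCorners ℝ E H) {M : Type*} [TopologicalSpace M] [ChartedSpace H M]
    (T R : VF I M) : TangentDist I M := fun x => Submodule.span ℝ {T x, R x}

/-- `W` is a nonsingular vector field spanning the characteristic foliation of the even
contact structure `E = [D,D]`:  `W` is tangent to `D` and `[W, E] ⊆ E`. -/
def SpansChar (I : ModelWithCorners ℝ E H) {M : Type*} [TopologicalSpace M] [ChartedSpace H M]
    [IsManifold I (⊤ : ℕ∞) M] (D : TangentDist I M) (W : VF I M) : Prop :=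
  SmoothVF I W ∧ (∀ x, W x ≠ 0) ∧ (∀ x, W x ∈ D x) ∧
  ∀ V, IsSection I (derivedDist I D) V → ∀ x, vfLie I W V x ∈ derivedDist I D x

/-- A Riemannian metric, given by its pointwise values. -/
structure RMetric (I : ModelWithCorners ℝ E H) (M : Type*) [TopologicalSpace M]
    [ChartedSpace H M] [IsManifold I (⊤ : ℕ∞) M] where
  val : ∀ x : M, TangentSpace I x →ₗ[ℝ] TangentSpace I x →ₗ[ℝ] ℝ
  symm : ∀ x u v, val x u v = val x v u
  posdef : ∀ x v, v ≠ 0 → 0 < val x v v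
  smooth' : ∀ V W, SmoothVF I V → SmoothVF I W → SmoothFn I (fun x => val x (V x) (W x))

/-- The Koszul formula: `koszul g X Y Z = g(∇_X Y, Z)` where `∇` is the Levi-Civita
connection of `g`. -/
def koszul (I : ModelWithCorners ℝ E H) {M : Type*} [TopologicalSpace M] [ChartedSpace H M]
    [IsManifold I (⊤ : ℕ∞) M] (g : RMetric I M) (X Y Z : VF I M) : M → ℝ := fun x =>
  (vderiv I X (fun y => g.val y (Y y) (Z y)) x + vderiv I Y (fun y => g.val y (X y) (Z y)) x
    - vderiv I Z (fun y => g.val y (X y) (Y y)) x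
    + g.val x (vfLie I X Y x) (Z x) - g.val x (vfLie I X Z x) (Y x)
    - g.val x (vfLie I Y Z x) (X x)) / 2

/-- A distribution `D` is totally geodesic for `g` iff every geodesic tangent to it at one
point stays tangent to it; equivalently (the standard characterization, which we take as the
definition) `∇_U U` is tangent to `D` for every section `U` of `D`, i.e. `g(∇_U U, V) = 0`
for every vector field `V` orthogonal to `D`. -/
def IsTotallyGeodesic (I : ModelWithCorners ℝ E H) {M : Type*} [TopologicalSpace M]
    [ChartedSpace H M] [IsManifold I (⊤ : ℕ∞) M] (g : RMetric I M)
    (D : TangentDist I M) : Prop :=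
  ∀ U, IsSection I D U → ∀ V, SmoothVF I V → (∀ x, ∀ u ∈ D x, g.val x (V x) u = 0) →
    ∀ x, koszul I g U U V x = 0

/-- A Killing vector field: `L_Z g = 0`, expressed on vector fields. -/
def IsKilling (I : ModelWithCorners ℝ E H) {M : Type*} [TopologicalSpace M] [ChartedSpace H M]
    [IsManifold I (⊤ : ℕ∞) M] (g : RMetric I M) (Z : VF I M) : Prop :=
  ∀ V W, SmoothVF I V → SmoothVF I W → ∀ x,
    vderiv I Z (fun y => g.val y (V y) (W y)) x
      = g.val x (vfLie I Z V x) (W x) + g.val x (V x) (vfLie I Z W x)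

/-- An Engel vector field: the flow of `Z` preserves `D`, i.e. `L_Z D ⊆ D`. -/
def IsEngelVF (I : ModelWithCorners ℝ E H) {M : Type*} [TopologicalSpace M] [ChartedSpace H M]
    [IsManifold I (⊤ : ℕ∞) M] (D : TangentDist I M) (Z : VF I M) : Prop :=
  SmoothVF I Z ∧ ∀ V, IsSection I D V → ∀ x, vfLie I Z V x ∈ D x

/-- A K-Engel structure: `D` is an Engel structure, `g` a Riemannian metric and `Z` a
(nowhere vanishing) vector field which is Engel, Killing and orthogonal to `E = [D,D]`. -/
structure IsKEngel (I : ModelWithCorners ℝ E H) {M : Type*} [TopologicalSpace M]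
    [ChartedSpace H M] [IsManifold I (⊤ : ℕ∞) M] (D : TangentDist I M)
    (g : RMetric I M) (Z : VF I M) : Prop where
  engel : IsEngel I D
  engelVF : IsEngelVF I D Z
  killing : IsKilling I g Z
  orth : ∀ x, ∀ v ∈ derivedDist I D x, g.val x (Z x) v = 0
  nonzero : ∀ x, Z x ≠ 0

/-- A `1`-form is closed. -/
def OneForm.IsClosed {I : ModelWithCorners ℝ E H} {M : Type*} [TopologicalSpace M]
    [ChartedSpace H M] [IsManifold I (⊤ : ℕ∞) M] (ω : OneForm I M) : Prop :=
  ∀ V W, SmoothVF I V → SmoothVF I W → ∀ x, ω.d V W x = 0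

/-- The Lie derivative `(L_Z ω)(V) = Z (ω V) - ω [Z,V]` of a `1`-form along a vector
field, as a function of vector fields. -/
def lieOneForm (I : ModelWithCorners ℝ E H) {M : Type*} [TopologicalSpace M] [ChartedSpace H M]
    [IsManifold I (⊤ : ℕ∞) M] (ω : OneForm I M) (Z V : VF I M) : M → ℝ := fun x =>
  vderiv I Z (fun y => ω.val y (V y)) x - ω.val x (vfLie I Z V x)

/-- The exterior derivative of a pointwise-defined `(m+1)`-form evaluated on `m+2` vector
fields, via the global Koszul formula. -/
def extDerEval (I : ModelWithCorners ℝ E H) {M : Type*} [TopologicalSpace M] [ChartedSpace H M]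
    [IsManifold I (⊤ : ℕ∞) M] {m : ℕ} (ν : FormPt I M (m+1)) (V : Fin (m+2) → VF I M) :
    M → ℝ := fun x =>
  (∑ i : Fin (m+2), (-1 : ℝ)^(i : ℕ) *
    vderiv I (V i) (fun y => ν.val y (fun l => V (i.succAbove l) y)) x)
  + ∑ i : Fin (m+2), ∑ j : Fin (m+2), if h : (i : ℕ) < (j : ℕ) then
      (-1 : ℝ)^((i : ℕ)+(j : ℕ)) * ν.val x (Fin.cons (vfLie I (V i) (V j) x)
        (fun l => V (j.succAbove ((⟨(i : ℕ), by have := j.2; omega⟩ : Fin (m+1)).succAbove l)) x))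
    else 0

/-- A pointwise-defined form is closed. -/
def FormPt.IsClosedForm {I : ModelWithCorners ℝ E H} {M : Type*} [TopologicalSpace M]
    [ChartedSpace H M] [IsManifold I (⊤ : ℕ∞) M] {m : ℕ} (ν : FormPt I M (m+1)) : Prop :=
  ∀ V : Fin (m+2) → VF I M, (∀ i, SmoothVF I (V i)) → ∀ x, extDerEval I ν V x = 0

/-- `φ : ℝ → M → M` is the flow of the vector field `Z`. -/
def IsFlowOf (I : ModelWithCorners ℝ E H) {M : Type*} [TopologicalSpace M] [ChartedSpace H M]
    [IsManifold I (⊤ : ℕ∞) M] (Z : VF I M) (φ : ℝ → M → M) : Prop :=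
  Continuous (fun p : ℝ × M => φ p.1 p.2) ∧ (∀ x, φ 0 x = x) ∧
  (∀ s t x, φ (s + t) x = φ s (φ t x)) ∧
  ∀ x t, HasMFDerivAt 𝓘(ℝ) I (fun s => φ s x) t
    ((1 : ℝ →L[ℝ] ℝ).smulRight (Z (φ t x)))

/-- `(η ∧ dη ∧ dη)(V₀,...,V₄)` up to a positive constant factor, for a pointwise `1`-form
`η`; pointwise nonvanishing of this expression on frames is the contact condition in
dimension 5. -/
def contactEval (I : ModelWithCorners ℝ E H) {M : Type*} [TopologicalSpace M] [ChartedSpace H M]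
    [IsManifold I (⊤ : ℕ∞) M] (η : ∀ z : M, TangentSpace I z →ₗ[ℝ] ℝ)
    (V : Fin 5 → VF I M) : M → ℝ := fun z =>
  ∑ σ : Equiv.Perm (Fin 5), ((Equiv.Perm.sign σ : ℤ) : ℝ) *
    (η z (V (σ 0) z) * dOfFun I (fun U x => η x (U x)) (V (σ 1)) (V (σ 2)) z *
      dOfFun I (fun U x => η x (U x)) (V (σ 3)) (V (σ 4)) z)

open VectorField Bundle

theorem vfLie_eq_mlieBracket [I.Boundaryless] (V W : VF I M) :
    vfLie I V W = mlieBracket I V W := by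
  have : IsManifold I 1 M := IsManifold.of_le (n := ((⊤ : ℕ∞) : WithTop ℕ∞)) (by simp)
  ext x
  have hev (U : VF I M) :
      (fun e => (mfderiv I 𝓘(ℝ, E) (extChartAt I x) ((extChartAt I x).symm e)
        (U ((extChartAt I x).symm e)) : E)) =ᶠ[nhds (extChartAt I x x)]
      (mpullbackWithin 𝓘(ℝ, E) I (extChartAt I x).symm U (range I)) := by
    filter_upwards [extChartAt_target_mem_nhds (I := I) x] with e he
    rw [mpullbackWithin_apply, ContinuousLinearMap.inverse_eq
      (mfderivWithin_extChartAt_symm_comp_mfderiv_extChartAt he)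
      (mfderiv_extChartAt_comp_mfderivWithin_extChartAt_symm he)]
    rfl
  have hinv : (mfderiv I 𝓘(ℝ, E) (extChartAt I x) x).inverse
      = mfderivWithin 𝓘(ℝ, E) I (extChartAt I x).symm (range I) (extChartAt I x x) :=
    ContinuousLinearMap.inverse_eq
      (mfderiv_extChartAt_comp_mfderivWithin_extChartAt_symm' (mem_extChartAt_source x))
      (mfderivWithin_extChartAt_symm_comp_mfderiv_extChartAt' (mem_extChartAt_source x))
  rw [← mlieBracketWithin_univ, mlieBracketWithin_apply, hinv, vfLie,
    (hev V).lieBracket_vectorField_eq (hev W)]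
  simp only [I.range_eq_univ, preimage_univ, inter_self, mfderivWithin_univ]
  exact congrArg (mfderiv 𝓘(ℝ, E) I (extChartAt I x).symm (extChartAt I x x))
    (congrFun (lieBracketWithin_univ (𝕜 := ℝ) (E := E)).symm _)

theorem SmoothVF.mdifferentiableAt {V : VF I M} (hV : SmoothVF I V) (x : M) :
    MDifferentiableAt I I.tangent (fun y => (⟨y, V y⟩ : TangentBundle I M)) x :=
  ContMDiff.mdifferentiable hV (by simp) x

theorem SmoothFn.mdifferentiableAt {f : M → ℝ} (hf : SmoothFn I f) (x : M) :
    MDifferentiableAt I 𝓘(ℝ) f x :=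
  ContMDiff.mdifferentiable hf (by simp) x

theorem SmoothVF.sub {V W : VF I M} (hV : SmoothVF I V) (hW : SmoothVF I W) :
    SmoothVF I (V - W) :=
  ContMDiff.sub_section hV hW

theorem SmoothVF.smul {f : M → ℝ} {V : VF I M} (hf : SmoothFn I f) (hV : SmoothVF I V) :
    SmoothVF I (f • V) :=
  ContMDiff.smul_section hf hV

theorem SmoothVF.vfLie [I.Boundaryless] [CompleteSpace E] {V W : VF I M}
    (hV : SmoothVF I V) (hW : SmoothVF I W) : SmoothVF I (vfLie I V W) := by
  rw [vfLie_eq_mlieBracket]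
  have : IsManifold I (((⊤ : ℕ∞) : WithTop ℕ∞) + 1) M := ‹IsManifold I (⊤ : ℕ∞) M›
  have : IsManifold I (minSmoothness ℝ 2) M := by
    rw [minSmoothness_of_isRCLikeNormedField]; infer_instance
  exact ContDiff.mlieBracket_vectorField hV hW
    (by rw [minSmoothness_of_isRCLikeNormedField]; rfl)

theorem exists_mdifferentiableAt_coeff_of_span_eq_top [FiniteDimensional ℝ E] {x : M}
    (hspan : Submodule.span ℝ {v : TangentSpace I x | ∃ X, SmoothVF I X ∧ X x = v} = ⊤)
    {V : VF I M} (hV : MDifferentiableAt I I.tangent (fun y => (⟨y, V y⟩ : TangentBundle I M)) x) :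
    ∃ (n : ℕ) (X : Fin n → VF I M) (f : Fin n → M → ℝ),
      (∀ i, SmoothVF I (X i)) ∧ (∀ i, MDifferentiableAt I 𝓘(ℝ) (f i) x) ∧
      ∀ᶠ y in nhds x, V y = ∑ i, f i y • X i y := by
  have : FiniteDimensional ℝ (TangentSpace I x) := inferInstanceAs (FiniteDimensional ℝ E)
  have : CompleteSpace E := FiniteDimensional.complete ℝ E
  let c := Basis.ofSpan hspan.ge
  have := FiniteDimensional.fintypeBasisIndex c
  let b := c.reindex (Fintype.equivFin _)
  have hb i : ∃ X, SmoothVF I X ∧ X x = b i := by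
    rw [Basis.reindex_apply]
    exact Basis.ofSpan_subset hspan.ge (mem_range_self _)
  choose X hX hXb using hb
  let e := trivializationAt E (TangentSpace I) x
  have hxe : x ∈ e.baseSet := mem_baseSet_trivializationAt E (TangentSpace I) x
  have he {y : M} (hy : y ∈ e.baseSet) (v : TangentSpace I y) :
      e.continuousLinearEquivAt ℝ y hy v = (e ⟨y, v⟩).2 := rfl
  let b' := b.map (e.continuousLinearEquivAt ℝ x hxe).toLinearEquiv
  have hXs i : MDifferentiableAt I 𝓘(ℝ, E) (fun y => (e ⟨y, X i y⟩).2) x :=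
    (mdifferentiableAt_section I (X i)).1 ((hX i).mdifferentiableAt x)
  have hVs : MDifferentiableAt I 𝓘(ℝ, E) (fun y => (e ⟨y, V y⟩).2) x :=
    (mdifferentiableAt_section I V).1 hV
  let A : M → E →L[ℝ] E := ∑ i, fun y =>
    ContinuousLinearMap.smulRightL ℝ E E (b'.coord i).toContinuousLinearMap (e ⟨y, X i y⟩).2
  have hA_apply y v : A y v = ∑ i, b'.coord i v • (e ⟨y, X i y⟩).2 := by
    simp [A]
  have hA : MDifferentiableAt I 𝓘(ℝ, E →L[ℝ] E) A x :=
    MDifferentiableAt.sum fun i _ =>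
      (ContinuousLinearMap.differentiableAt _).comp_mdifferentiableAt (hXs i)
  have hAx : A x = (ContinuousLinearEquiv.refl ℝ E : E →L[ℝ] E) := by
    ext v
    rw [hA_apply]
    have h i : (e ⟨x, X i x⟩).2 = b' i := by
      rw [hXb, ← he hxe]
      rfl
    simp_rw [h]
    exact b'.sum_repr v
  have hinv : MDifferentiableAt I 𝓘(ℝ, E →L[ℝ] E) (fun y => (A y).inverse) x := by
    refine DifferentiableAt.comp_mdifferentiableAt (g := ContinuousLinearMap.inverse) ?_ hA
    rw [hAx]
    exact (contDiffAt_map_inverse (n := 1) _).differentiableAt one_ne_zero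
  refine ⟨_, X, fun i y => b'.coord i ((A y).inverse (e ⟨y, V y⟩).2), hX, fun i => ?_, ?_⟩
  · exact (ContinuousLinearMap.differentiableAt
      (b'.coord i).toContinuousLinearMap).comp_mdifferentiableAt (hinv.clm_apply hVs)
  · have h1 : ∀ᶠ y in nhds x, A y ∈ range ContinuousLinearEquiv.toContinuousLinearMap := by
      refine hA.continuousAt.eventually ?_
      rw [hAx]
      exact ContinuousLinearEquiv.nhds _
    filter_upwards [h1, e.open_baseSet.mem_nhds hxe] with y ⟨B, hB⟩ hy
    apply (e.continuousLinearEquivAt ℝ y hy).injective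
    rw [map_sum]
    simp_rw [map_smul, he hy]
    rw [← hA_apply, ← hB]
    simp

theorem OneForm.mdifferentiableAt [FiniteDimensional ℝ E] (ω : OneForm I M) {x : M}
    (hspan : Submodule.span ℝ {v : TangentSpace I x | ∃ X, SmoothVF I X ∧ X x = v} = ⊤)
    {V : VF I M} (hV : MDifferentiableAt I I.tangent (fun y => (⟨y, V y⟩ : TangentBundle I M)) x) :
    MDifferentiableAt I 𝓘(ℝ) (fun y => ω.val y (V y)) x := by
  obtain ⟨n, X, f, hX, hf, hV⟩ := exists_mdifferentiableAt_coeff_of_span_eq_top hspan hV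
  have h : MDifferentiableAt I 𝓘(ℝ) (∑ i, (f i * fun y => ω.val y (X i y))) x :=
    MDifferentiableAt.sum fun i _ => (hf i).mul ((ω.smooth' _ (hX i)).mdifferentiableAt x)
  refine h.congr_of_eventuallyEq ?_
  filter_upwards [hV] with y hy
  simp [hy]

theorem vderiv_add {V : VF I M} {f g : M → ℝ} {x : M} (hf : MDifferentiableAt I 𝓘(ℝ) f x)
    (hg : MDifferentiableAt I 𝓘(ℝ) g x) :
    vderiv I V (fun y => f y + g y) x = vderiv I V f x + vderiv I V g x :=
  congrArg (· (V x)) (mvfderiv_fun_add hf hg)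

theorem vderiv_mul {V : VF I M} {f g : M → ℝ} {x : M} (hf : MDifferentiableAt I 𝓘(ℝ) f x)
    (hg : MDifferentiableAt I 𝓘(ℝ) g x) :
    vderiv I V (fun y => f y * g y) x = f x * vderiv I V g x + g x * vderiv I V f x :=
  congrArg (· (V x)) (mvfderiv_fun_mul hf hg)

theorem vderiv_const (V : VF I M) (c : ℝ) (x : M) : vderiv I V (fun _ => c) x = 0 := by
  simp only [vderiv, mfderiv_const]
  rfl

theorem vderiv_smul_left (f g : M → ℝ) (V : VF I M) (x : M) :
    vderiv I (f • V) g x = f x * vderiv I V g x :=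
  map_smul (mfderiv I 𝓘(ℝ) g x) (f x) (V x)

theorem vderiv_add_left (g : M → ℝ) (V W : VF I M) (x : M) :
    vderiv I (V + W) g x = vderiv I V g x + vderiv I W g x :=
  map_add (mfderiv I 𝓘(ℝ) g x) (V x) (W x)

section

variable [I.Boundaryless]

theorem vfLie_swap (V W : VF I M) (x : M) : vfLie I V W x = -vfLie I W V x := by
  simp only [vfLie_eq_mlieBracket]
  exact mlieBracket_swap_apply

theorem vfLie_smul_left [CompleteSpace E] {f : M → ℝ} {V W : VF I M} {x : M}
    (hf : MDifferentiableAt I 𝓘(ℝ) f x)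
    (hV : MDifferentiableAt I I.tangent (fun y => (⟨y, V y⟩ : TangentBundle I M)) x) :
    vfLie I (f • V) W x = -vderiv I W f x • V x + f x • vfLie I V W x := by
  simp only [vfLie_eq_mlieBracket]
  exact mlieBracket_smul_left hf hV

theorem vfLie_add_left [CompleteSpace E] {V V' W : VF I M} {x : M}
    (hV : MDifferentiableAt I I.tangent (fun y => (⟨y, V y⟩ : TangentBundle I M)) x)
    (hV' : MDifferentiableAt I I.tangent (fun y => (⟨y, V' y⟩ : TangentBundle I M)) x) :
    vfLie I (V + V') W x = vfLie I V W x + vfLie I V' W x := by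
  simp only [vfLie_eq_mlieBracket]
  exact mlieBracket_add_left hV hV'

theorem vfLie_vfLie_left [CompleteSpace E] {U V W : VF I M} (hU : SmoothVF I U)
    (hV : SmoothVF I V) (hW : SmoothVF I W) (x : M) :
    vfLie I (vfLie I U V) W x = vfLie I U (vfLie I V W) x - vfLie I V (vfLie I U W) x := by
  simp only [vfLie_eq_mlieBracket]
  have : IsManifold I (minSmoothness ℝ 3) M := by
    rw [minSmoothness_of_isRCLikeNormedField]; infer_instance
  have h2 : minSmoothness ℝ 2 ≤ ((⊤ : ℕ∞) : WithTop ℕ∞) := by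
    rw [minSmoothness_of_isRCLikeNormedField]
    exact WithTop.coe_le_coe.2 le_top
  rw [leibniz_identity_mlieBracket_apply ((hU x).of_le h2) ((hV x).of_le h2) ((hW x).of_le h2)]
  abel

theorem OneForm.d_swap (ω : OneForm I M) (V W : VF I M) (x : M) : ω.d V W x = -ω.d W V x := by
  simp only [OneForm.d, dOfFun, vfLie_swap V W x, map_neg]
  ring

theorem OneForm.tensorialAt_d [FiniteDimensional ℝ E] (ω : OneForm I M) {x : M}
    (hspan : Submodule.span ℝ {v : TangentSpace I x | ∃ X, SmoothVF I X ∧ X x = v} = ⊤)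
    (W : VF I M) :
    TensorialAt I E (fun V => ω.d V W x) x := by
  have : CompleteSpace E := FiniteDimensional.complete ℝ E
  constructor
  · intro f V hf hV
    have h := vderiv_mul (V := W) hf (ω.mdifferentiableAt hspan hV)
    simp only [OneForm.d, dOfFun, vderiv_smul_left, vfLie_smul_left hf hV, Pi.smul_apply', map_smul,
      smul_eq_mul, map_add, h]
    ring
  · intro V V' hV hV'
    have h := vderiv_add (V := W) (ω.mdifferentiableAt hspan hV) (ω.mdifferentiableAt hspan hV')
    simp only [OneForm.d, dOfFun, vderiv_add_left, vfLie_add_left hV hV', Pi.add_apply, map_add, h]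
    ring

theorem OneForm.exists_bilin_d [FiniteDimensional ℝ E] (ω : OneForm I M) {x : M}
    (hspan : Submodule.span ℝ {v : TangentSpace I x | ∃ X, SmoothVF I X ∧ X x = v} = ⊤) :
    ∃ B : TangentSpace I x →L[ℝ] TangentSpace I x →L[ℝ] ℝ, (∀ v, B v v = 0) ∧
      ∀ V W, SmoothVF I V → SmoothVF I W → ω.d V W x = B (V x) (W x) := by
  have hl (W : VF I M) (_ : MDifferentiableAt I I.tangent
      (fun y => (⟨y, W y⟩ : TangentBundle I M)) x) := ω.tensorialAt_d hspan W
  have hr (V : VF I M) (_ : MDifferentiableAt I I.tangent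
      (fun y => (⟨y, V y⟩ : TangentBundle I M)) x) :
      TensorialAt I E (fun W => ω.d V W x) x := by
    have h : (fun W => ω.d V W x) = fun W => -ω.d W V x := funext fun W => ω.d_swap V W x
    rw [h]
    exact ⟨fun hf hW => by simp [(ω.tensorialAt_d hspan V).smul hf hW],
      fun hW hW' => by simp [(ω.tensorialAt_d hspan V).add hW hW', add_comm]⟩
  refine ⟨TensorialAt.mkHom₂ (fun V W => ω.d V W x) x hl hr, fun v => ?_, fun V W hV hW => ?_⟩
  · rw [TensorialAt.mkHom₂_apply_eq_extend]
    have := ω.d_swap (FiberBundle.extend E v) (FiberBundle.extend E v) x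
    linarith
  · exact (TensorialAt.mkHom₂_apply hl hr (hV.mdifferentiableAt x) (hW.mdifferentiableAt x)).symm

end

theorem span_smoothVF_eq_top [I.Boundaryless] [CompleteSpace E] {D : TangentDist I M} {x : M}
    (hD : derivedDist I D x = ⊤) :
    Submodule.span ℝ {v : TangentSpace I x | ∃ X, SmoothVF I X ∧ X x = v} = ⊤ := by
  rw [eq_top_iff, ← hD]
  refine Submodule.span_mono ?_
  rintro v (⟨V, hV, rfl⟩ | ⟨V, W, hV, hW, rfl⟩)
  · exact ⟨V, hV.1, rfl⟩
  · exact ⟨vfLie I V W, hV.1.vfLie hW.1, rfl⟩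

theorem vfLie_mem_derivedDist {D : TangentDist I M} {A B : VF I M} (hA : IsSection I D A)
    (hB : IsSection I D B) (x : M) : vfLie I A B x ∈ derivedDist I D x :=
  Submodule.subset_span (Or.inr ⟨A, B, hA, hB, rfl⟩)

theorem OneForm.d_eq_neg_vfLie (ω : OneForm I M) {V W : VF I M} {a b : ℝ}
    (hV : ∀ x, ω.val x (V x) = a) (hW : ∀ x, ω.val x (W x) = b) (x : M) :
    ω.d V W x = -ω.val x (vfLie I V W x) := by
  simp [OneForm.d, dOfFun, hV, hW, vderiv_const]

section Reeb

variable {D : TangentDist I M} {α β : OneForm I M} {T R : VF I M}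

theorem EngelDefiningForms.mem_iff (h : EngelDefiningForms I D α β) {x : M}
    {v : TangentSpace I x} : v ∈ D x ↔ α.val x v = 0 ∧ β.val x v = 0 := by
  rw [h.1 x]
  simp

theorem EngelDefiningForms.alpha_vfLie (h : EngelDefiningForms I D α β) {A B : VF I M}
    (hA : IsSection I D A) (hB : IsSection I D B) (x : M) : α.val x (vfLie I A B x) = 0 := by
  have := vfLie_mem_derivedDist hA hB x
  rwa [h.2 x] at this

theorem IsReebPair.d_T (h : IsReebPair I α β T R) [I.Boundaryless] {W : VF I M}
    (hW : SmoothVF I W) (x : M) : β.d T W x = -(β.d R T x * α.val x (W x)) := by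
  have := h.insT R W h.smoothR hW x
  simp only [wedge1_2, h.alphaT, h.alphaR, β.d_swap T R] at this
  linarith

theorem IsReebPair.d_R (h : IsReebPair I α β T R) {W : VF I M}
    (hW : SmoothVF I W) (x : M) : β.d R W x = β.d R T x * β.val x (W x) := by
  have := h.insR T W h.smoothT hW x
  simp only [wedge1_2, h.betaT, h.betaR] at this
  linarith

theorem IsReebPair.beta_vfLie_T (h : IsReebPair I α β T R) [I.Boundaryless] {W : VF I M}
    (hW : SmoothVF I W) (x : M) :
    β.val x (vfLie I T W x)
      = vderiv I T (fun y => β.val y (W y)) x + β.d R T x * α.val x (W x) := by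
  have := h.d_T hW x
  rw [OneForm.d, dOfFun] at this
  simp only [h.betaT, vderiv_const] at this
  linarith

theorem IsReebPair.beta_vfLie_R (h : IsReebPair I α β T R) {W : VF I M}
    (hW : SmoothVF I W) (x : M) :
    β.val x (vfLie I R W x)
      = vderiv I R (fun y => β.val y (W y)) x - β.d R T x * β.val x (W x) := by
  have := h.d_R hW x
  rw [OneForm.d, dOfFun] at this
  simp only [h.betaR, vderiv_const] at this
  linarith

theorem IsReebPair.sub_mem (h : IsReebPair I α β T R) (hforms : EngelDefiningForms I D α β)
    {x : M} (v : TangentSpace I x) :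
    v - β.val x v • T x - α.val x v • R x ∈ D x := by
  simp [hforms.mem_iff, h.alphaT, h.alphaR, h.betaT, h.betaR]

theorem IsReebPair.isSection_sub (h : IsReebPair I α β T R)
    (hforms : EngelDefiningForms I D α β) {V : VF I M} (hV : SmoothVF I V) :
    IsSection I D
      (V - (fun y => β.val y (V y)) • T - (fun y => α.val y (V y)) • R) :=
  ⟨(hV.sub (h.smoothT.smul (β.smooth' V hV))).sub (h.smoothR.smul (α.smooth' V hV)),
    fun x => h.sub_mem hforms (V x)⟩

/-- The restriction of `dβ` to `D` is nondegenerate. -/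
theorem IsReebPair.eq_zero_of_forall_section (h : IsReebPair I α β T R)
    (hforms : EngelDefiningForms I D α β) {x : M} (hrank : finrank ℝ (D x) = 2)
    {B : TangentSpace I x →L[ℝ] TangentSpace I x →L[ℝ] ℝ} (hBalt : ∀ v, B v v = 0)
    (hB : ∀ V W, SmoothVF I V → SmoothVF I W → β.d V W x = B (V x) (W x))
    {v : TangentSpace I x} (hv : v ∈ D x) (hvB : ∀ A, IsSection I D A → B v (A x) = 0) :
    v = 0 := by
  obtain ⟨A, A', hA, hA', hne⟩ : ∃ A A', IsSection I D A ∧ IsSection I D A' ∧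
      B (A x) (A' x) ≠ 0 := by
    by_contra! hcon
    have hle : derivedDist I D x ≤ LinearMap.ker (β.val x) := by
      refine Submodule.span_le.2 ?_
      rintro w (⟨V, hV, rfl⟩ | ⟨V, W, hV, hW, rfl⟩)
      · exact (hforms.mem_iff.1 (hV.2 x)).2
      · have := hcon V W hV hW
        rw [← hB V W hV.1 hW.1, β.d_eq_neg_vfLie (fun y => (hforms.mem_iff.1 (hV.2 y)).2)
          (fun y => (hforms.mem_iff.1 (hW.2 y)).2)] at this
        exact neg_eq_zero.1 this
    have hT : T x ∈ derivedDist I D x := by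
      rw [hforms.2 x]
      exact h.alphaT x
    exact one_ne_zero ((h.betaT x).symm.trans (hle hT))
  have hswap : B (A' x) (A x) ≠ 0 := by
    have := hBalt (A x + A' x)
    simp only [map_add, add_apply, hBalt, zero_add, add_zero] at this
    intro h0
    exact hne (by linarith)
  have hdep : ¬ LinearIndependent ℝ
      (![⟨v, hv⟩, ⟨A x, hA.2 x⟩, ⟨A' x, hA'.2 x⟩] : Fin 3 → D x) := by
    intro hli
    have : Module.Finite ℝ (D x) := Module.finite_of_finrank_pos (by omega)
    have := hli.fintype_card_le_finrank
    simp [hrank] at this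
  obtain ⟨g, hg, i, hi⟩ := Fintype.not_linearIndependent_iff.1 hdep
  have hg' : g 0 • v + g 1 • A x + g 2 • A' x = 0 := by
    have := congrArg (Submodule.subtype (D x)) hg
    simpa [Fin.sum_univ_three] using this
  have h2 : g 2 = 0 := by
    have := congrArg (B · (A x)) hg'
    simpa [hvB A hA, hBalt, hswap] using this
  have h1 : g 1 = 0 := by
    have := congrArg (B · (A' x)) hg'
    simpa [hvB A' hA', hBalt, hne] using this
  have h0 : g 0 ≠ 0 := by
    fin_cases i
    · exact hi
    · exact absurd h1 hi
    · exact absurd h2 hi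
  simpa [h1, h2, h0] using hg'

variable [I.Boundaryless] [FiniteDimensional ℝ E]

theorem IsReebPair.d_add_eq_zero_of_mem (h : IsReebPair I α β T R) {x : M}
    (hspan : Submodule.span ℝ {v : TangentSpace I x | ∃ X, SmoothVF I X ∧ X x = v} = ⊤)
    {V W : VF I M} (hV : SmoothVF I V) (hW : SmoothVF I W) (hVx : V x ∈ reebDist I T R x) :
    β.d V W x + β.d R T x * (β.val x (V x) * α.val x (W x)
      - β.val x (W x) * α.val x (V x)) = 0 := by
  obtain ⟨B, -, hB⟩ := β.exists_bilin_d hspan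
  obtain ⟨a, b, hab⟩ := Submodule.mem_span_pair.1 hVx
  have hT := h.d_T hW x
  have hR := h.d_R hW x
  rw [hB T W h.smoothT hW] at hT
  rw [hB R W h.smoothR hW] at hR
  rw [hB V W hV hW, ← hab]
  simp only [map_add, map_smul, add_apply, smul_apply,
    smul_eq_mul, h.alphaT, h.alphaR, h.betaT, h.betaR, hT, hR]
  ring

theorem IsReebPair.mem_reebDist_of_forall_section (h : IsReebPair I α β T R)
    (hforms : EngelDefiningForms I D α β) {x : M} (hrank : finrank ℝ (D x) = 2)
    (hspan : Submodule.span ℝ {v : TangentSpace I x | ∃ X, SmoothVF I X ∧ X x = v} = ⊤)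
    {V : VF I M} (hV : SmoothVF I V) (hVA : ∀ A, IsSection I D A → β.d V A x = 0) :
    V x ∈ reebDist I T R x := by
  obtain ⟨B, hBalt, hB⟩ := β.exists_bilin_d hspan
  have h0 : V x - β.val x (V x) • T x - α.val x (V x) • R x = 0 := by
    refine h.eq_zero_of_forall_section hforms hrank hBalt hB (h.sub_mem hforms _) fun A hA => ?_
    have hAx := hforms.mem_iff.1 (hA.2 x)
    simp only [map_sub, map_smul, sub_apply, smul_apply,
      ← hB _ _ hV hA.1, ← hB _ _ h.smoothT hA.1, ← hB _ _ h.smoothR hA.1, hVA A hA,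
      h.d_T hA.1, h.d_R hA.1, hAx]
    simp
  refine Submodule.mem_span_pair.2 ⟨β.val x (V x), α.val x (V x), ?_⟩
  rw [sub_sub, sub_eq_zero] at h0
  exact h0.symm

theorem IsReebPair.smoothFn_d (h : IsReebPair I α β T R) : SmoothFn I (β.d R T) := by
  have : CompleteSpace E := FiniteDimensional.complete ℝ E
  have heq : β.d R T = fun x => -β.val x (vfLie I R T x) :=
    funext (β.d_eq_neg_vfLie h.betaR h.betaT)
  rw [heq]
  exact ContMDiff.neg (β.smooth' _ (h.smoothR.vfLie h.smoothT))

/-- The product of a smooth function and a `1`-form. -/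
def OneForm.fnSMul (f : M → ℝ) (hf : SmoothFn I f) (ω : OneForm I M) : OneForm I M where
  val x := f x • ω.val x
  smooth' V hV := ContMDiff.mul hf (ω.smooth' V hV)

theorem IsReebPair.d_vfLie_eq (h : IsReebPair I α β T R) (hforms : EngelDefiningForms I D α β)
    {A : VF I M} (hA : IsSection I D A) (x : M) :
    β.d (vfLie I T R) A x = (α.fnSMul (β.d R T) h.smoothFn_d).d R A x := by
  have : CompleteSpace E := FiniteDimensional.complete ℝ E
  have hαA y : α.val y (A y) = 0 := (hforms.mem_iff.1 (hA.2 y)).1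
  have hβA y : β.val y (A y) = 0 := (hforms.mem_iff.1 (hA.2 y)).2
  have hTR y : β.val y (vfLie I T R y) = β.d R T y := by
    simp [h.beta_vfLie_T h.smoothR, h.betaR, h.alphaR, vderiv_const]
  have hTA y : β.val y (vfLie I T A y) = 0 := by
    simp [h.beta_vfLie_T hA.1, hβA, hαA, vderiv_const]
  have hRA y : β.val y (vfLie I R A y) = 0 := by
    simp [h.beta_vfLie_R hA.1, hβA, vderiv_const]
  have hTRA : β.val x (vfLie I T (vfLie I R A) x) = β.d R T x * α.val x (vfLie I R A x) := by
    simp [h.beta_vfLie_T (h.smoothR.vfLie hA.1), hRA, vderiv_const]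
  have hRTA : β.val x (vfLie I R (vfLie I T A) x) = 0 := by
    simp [h.beta_vfLie_R (h.smoothT.vfLie hA.1), hTA, vderiv_const]
  rw [OneForm.d, dOfFun, OneForm.d, dOfFun]
  simp only [OneForm.fnSMul, LinearMap.smul_apply, smul_eq_mul, hβA, hαA, h.alphaR, hTR,
    vfLie_vfLie_left h.smoothT h.smoothR hA.1, map_sub, hTRA, hRTA, mul_zero, mul_one,
    vderiv_const]
  ring

theorem IsReebPair.vfLie_mem_reebDist_of_section (h : IsReebPair I α β T R) {W : VF I M} {x : M}
    (hT : vfLie I T W x ∈ reebDist I T R x) (hR : vfLie I R W x ∈ reebDist I T R x)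
    {V : VF I M} (hV : IsSection I (reebDist I T R) V) :
    vfLie I V W x ∈ reebDist I T R x := by
  have : CompleteSpace E := FiniteDimensional.complete ℝ E
  have hVeq : V = (fun y => β.val y (V y)) • T + (fun y => α.val y (V y)) • R := by
    funext y
    obtain ⟨a, b, hab⟩ := Submodule.mem_span_pair.1 (hV.2 y)
    simp [← hab, h.alphaT, h.alphaR, h.betaT, h.betaR]
  have hf := β.smooth' V hV.1
  have hg := α.smooth' V hV.1
  have hTx : T x ∈ reebDist I T R x := Submodule.subset_span (by simp)
  have hRx : R x ∈ reebDist I T R x := Submodule.subset_span (by simp)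
  rw [hVeq, vfLie_add_left ((h.smoothT.smul hf).mdifferentiableAt x)
    ((h.smoothR.smul hg).mdifferentiableAt x),
    vfLie_smul_left (hf.mdifferentiableAt x) (h.smoothT.mdifferentiableAt x),
    vfLie_smul_left (hg.mdifferentiableAt x) (h.smoothR.mdifferentiableAt x)]
  exact add_mem (add_mem (Submodule.smul_mem _ _ hTx) (Submodule.smul_mem _ _ hT))
    (add_mem (Submodule.smul_mem _ _ hRx) (Submodule.smul_mem _ _ hR))

theorem IsReebPair.isIntegrableDist_iff (h : IsReebPair I α β T R) :
    IsIntegrableDist I (reebDist I T R) ↔ ∀ x, vfLie I T R x ∈ reebDist I T R x := by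
  constructor
  · intro hint
    exact hint T R ⟨h.smoothT, fun x => Submodule.subset_span (by simp)⟩
      ⟨h.smoothR, fun x => Submodule.subset_span (by simp)⟩
  · intro hTR V W hV hW x
    have hself (X : VF I M) : vfLie I X X x ∈ reebDist I T R x := by
      simp [vfLie_eq_mlieBracket]
    have hswap {X Y : VF I M} (hXY : vfLie I X Y x ∈ reebDist I T R x) :
        vfLie I Y X x ∈ reebDist I T R x := by
      rw [vfLie_swap]
      exact neg_mem hXY
    exact h.vfLie_mem_reebDist_of_section
      (hswap (h.vfLie_mem_reebDist_of_section (hself T) (hswap (hTR x)) hW))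
      (hswap (h.vfLie_mem_reebDist_of_section (hTR x) (hself R) hW)) hV

theorem IsReebPair.wedge_eq_zero (h : IsReebPair I α β T R)
    (hforms : EngelDefiningForms I D α β) {x : M}
    (hspan : Submodule.span ℝ {v : TangentSpace I x | ∃ X, SmoothVF I X ∧ X x = v} = ⊤)
    {γ : OneForm I M} (hRA : ∀ A, IsSection I D A → γ.d R A x = 0)
    (hAA : ∀ A A', IsSection I D A → IsSection I D A' → γ.d A A' x = 0)
    {U V W : VF I M} (hU : SmoothVF I U) (hV : SmoothVF I V) (hW : SmoothVF I W) :
    γ.d U V x * β.val x (W x) - γ.d U W x * β.val x (V x) + γ.d V W x * β.val x (U x) = 0 := by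
  obtain ⟨G, hGalt, hG⟩ := γ.exists_bilin_d hspan
  have hswap (v w : TangentSpace I x) : G v w = -G w v := by
    have := hGalt (v + w)
    simp only [map_add, add_apply, hGalt, zero_add, add_zero] at this
    linarith
  let P (X : VF I M) : VF I M :=
    X - (fun y => β.val y (X y)) • T - (fun y => α.val y (X y)) • R
  have hP {X : VF I M} (hX : SmoothVF I X) : IsSection I D (P X) := h.isSection_sub hforms hX
  have hX (X : VF I M) : X x = β.val x (X x) • T x + α.val x (X x) • R x + P X x := by
    simp [P]
  have hRP {X : VF I M} (hX : SmoothVF I X) : G (R x) (P X x) = 0 := by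
    rw [← hG _ _ h.smoothR (hP hX).1, hRA _ (hP hX)]
  have hPP {X Y : VF I M} (hX : SmoothVF I X) (hY : SmoothVF I Y) : G (P X x) (P Y x) = 0 := by
    rw [← hG _ _ (hP hX).1 (hP hY).1, hAA _ _ (hP hX) (hP hY)]
  have hexp {X Y : VF I M} (hXs : SmoothVF I X) (hYs : SmoothVF I Y) : γ.d X Y x =
      (β.val x (X x) * α.val x (Y x) - α.val x (X x) * β.val x (Y x)) * G (T x) (R x)
        + β.val x (X x) * G (T x) (P Y x) - β.val x (Y x) * G (T x) (P X x) := by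
    rw [hG X Y hXs hYs]
    conv_lhs => rw [hX X, hX Y]
    simp only [map_add, map_smul, add_apply, smul_apply,
      smul_eq_mul, hGalt, hRP hXs, hRP hYs, hPP hXs hYs, hswap (P X x) (T x),
      hswap (P X x) (R x), hswap (R x) (T x)]
    ring
  rw [hexp hU hV, hexp hU hW, hexp hV hW]
  ring

end Reeb

/-- Let `D = ker α∧β` be an Engel structure with a choice of Engel defining
forms, let `𝓡 = ⟨T, R⟩` be the associated Reeb distribution, and set `c_TR := dβ(R,T)`.
Then `𝓡 = ker (dβ + c_TR β∧α)`, and `𝓡` is integrable if and only if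
`d(c_TR α) ∧ β = 0`. -/
theorem reeb_distribution_eq_kernel_and_integrability_iff {M : Type*} [TopologicalSpace M]
    [ChartedSpace (EuclideanSpace ℝ (Fin 4)) M] [IsManifold (𝓡 4) (⊤ : ℕ∞) M]
    (D : TangentDist (𝓡 4) M) (α β : OneForm (𝓡 4) M)
    (hD : IsEngel (𝓡 4) D) (hforms : EngelDefiningForms (𝓡 4) D α β)
    (T R : VF (𝓡 4) M) (hTR : IsReebPair (𝓡 4) α β T R)
    (cTR : M → ℝ) (hc : ∀ x, cTR x = β.d R T x) :
    -- `𝓡 = ker (dβ + c_TR β ∧ α)`: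
    (∀ V, SmoothVF (𝓡 4) V →
      ((∀ x, V x ∈ reebDist (𝓡 4) T R x) ↔
        (∀ W', SmoothVF (𝓡 4) W' → ∀ x,
          β.d V W' x + cTR x * (β.val x (V x) * α.val x (W' x)
            - β.val x (W' x) * α.val x (V x)) = 0)))
    ∧
    -- `𝓡` is integrable iff `d(c_TR α) ∧ β = 0`:
    (IsIntegrableDist (𝓡 4) (reebDist (𝓡 4) T R) ↔
      (∀ U V W', SmoothVF (𝓡 4) U → SmoothVF (𝓡 4) V → SmoothVF (𝓡 4) W' → ∀ x,
        dOfFun (𝓡 4) (fun U' y => cTR y * α.val y (U' y)) U V x * β.val x (W' x)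
          - dOfFun (𝓡 4) (fun U' y => cTR y * α.val y (U' y)) U W' x * β.val x (V x)
          + dOfFun (𝓡 4) (fun U' y => cTR y * α.val y (U' y)) V W' x * β.val x (U x)
          = 0)) := by
  obtain rfl : cTR = β.d R T := funext hc
  have hspan x := span_smoothVF_eq_top (hD.2.2 x)
  have hα {A : VF (𝓡 4) M} (hA : IsSection (𝓡 4) D A) y : α.val y (A y) = 0 :=
    (hforms.mem_iff.1 (hA.2 y)).1
  have hβ {A : VF (𝓡 4) M} (hA : IsSection (𝓡 4) D A) y : β.val y (A y) = 0 :=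
    (hforms.mem_iff.1 (hA.2 y)).2
  refine ⟨fun V hV => ⟨fun hVx W hW x => hTR.d_add_eq_zero_of_mem (hspan x) hV hW (hVx x),
    fun hker x => ?_⟩, ?_⟩
  · refine hTR.mem_reebDist_of_forall_section hforms (hD.1 x) (hspan x) hV fun A hA => ?_
    simpa [hα hA, hβ hA] using hker A hA.1 x
  rw [hTR.isIntegrableDist_iff]
  have hbracket := hTR.smoothT.vfLie hTR.smoothR
  constructor
  · intro hmem U V W hU hV hW x
    refine hTR.wedge_eq_zero hforms (hspan x) (γ := α.fnSMul (β.d R T) hTR.smoothFn_d)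
      (fun A hA => ?_) (fun A A' hA hA' => ?_) hU hV hW
    · rw [← hTR.d_vfLie_eq hforms hA]
      simpa [hα hA, hβ hA] using
        hTR.d_add_eq_zero_of_mem (hspan x) hbracket hA.1 (hmem x)
    · rw [OneForm.d_eq_neg_vfLie (a := 0) (b := 0)]
      · simp [OneForm.fnSMul, hforms.alpha_vfLie hA hA']
      · simp [OneForm.fnSMul, hα hA]
      · simp [OneForm.fnSMul, hα hA']
  · intro hwedge x
    refine hTR.mem_reebDist_of_forall_section hforms (hD.1 x) (hspan x) hbracket fun A hA => ?_
    rw [hTR.d_vfLie_eq hforms hA]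
    have := hwedge R A T hTR.smoothR hA.1 hTR.smoothT x
    rw [hβ hA, hTR.betaT, hTR.betaR, mul_one, mul_zero, mul_zero, sub_zero, add_zero] at this
    exact this

end
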